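/- arXiv:2212.02619 — 3 statements merged into one kernel-verified Lean document; each statement's English description precedes it below -/
import Mathlib

section
/- Let r ≥ 2 and m ≥ r + 1, and let α₁, …, α_r, b_{r+1}, …, b_m be elements of a commutative ring. Then K(α₁,…,α_{r−1}, α_r + 1)·K(α₂,…,α_r, b_{r+1},…,b_m) − K(α₁,…,α_r, b_{r+1},…,b_m)·K(α₂,…,α_{r−1}, α_r + 1) = (−1)^{r+1}·K(b_{r+1} − 1, b_{r+2},…,b_m). -/
/-- Auxiliary continuant, recursing on the *first* element of the (reversed) list. -/
def contAux {R : Type*} [CommRing R] : List R → R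
  | [] => 1
  | [x] => x
  | x :: y :: t => x * contAux (y :: t) + contAux t

/-- The continuant `K(x₁,…,xₙ)` with `K() = 1`, `K(x₁) = x₁`, and
`K(x₁,…,xₙ) = xₙ·K(x₁,…,xₙ₋₁) + K(x₁,…,xₙ₋₂)`. -/
def cont {R : Type*} [CommRing R] (l : List R) : R := contAux l.reverse


theorem contAux_concat_concat {R : Type*} [CommRing R] (y x : R) :
    ∀ l : List R, contAux (l ++ [y, x]) = x * contAux (l ++ [y]) + contAux l
  | [] => by simp [contAux]; ring
  | [z] => by simp [contAux]; ring
  | z :: w :: t => by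
    have h₁ := contAux_concat_concat y x (w :: t)
    have h₂ := contAux_concat_concat y x t
    simp only [List.cons_append, contAux] at h₁ h₂ ⊢
    rw [h₁, h₂]
    ring

theorem cont_cons_cons {R : Type*} [CommRing R] (x y : R) (t : List R) :
    cont (x :: y :: t) = x * cont (y :: t) + cont t := by
  simpa [cont] using contAux_concat_concat y x t.reverse

theorem cont_nil {R : Type*} [CommRing R] : cont ([] : List R) = 1 := rfl

theorem cont_singleton {R : Type*} [CommRing R] (x : R) : cont [x] = x := rfl

theorem cont_sub_one_cons {R : Type*} [CommRing R] (b : R) (bs : List R) :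
    cont ((b - 1) :: bs) = cont (b :: bs) - cont bs := by
  cases bs with
  | nil => simp only [cont_nil, cont_singleton]
  | cons c t =>
    simp only [cont_cons_cons]
    ring

/-- for `r ≥ 2` and `m ≥ r + 1` (here `(α₁,…,α_r) = A ++ [ar]` with
`A = (α₁,…,α_{r−1})` nonempty, and `(b_{r+1},…,b_m) = b :: bs` nonempty):
`K(α₁,…,α_{r−1}, α_r+1)·K(α₂,…,α_r, b_{r+1},…,b_m)
  − K(α₁,…,α_r, b_{r+1},…,b_m)·K(α₂,…,α_{r−1}, α_r+1)
  = (−1)^{r+1}·K(b_{r+1}−1, b_{r+2},…,b_m)`. -/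
theorem cont_det_tail_block {R : Type*} [CommRing R] (A : List R) (ar : R)
    (b : R) (bs : List R) (hA : 1 ≤ A.length) :
    cont (A ++ [ar + 1]) * cont (A.tail ++ [ar] ++ (b :: bs))
      - cont (A ++ [ar] ++ (b :: bs)) * cont (A.tail ++ [ar + 1])
      = (-1 : R) ^ (A.length + 1 + 1) * cont ((b - 1) :: bs) := by
  induction A with
  | nil => simp at hA
  | cons x A ih =>
    cases A with
    | nil =>
      simp only [List.cons_append, List.nil_append, List.tail_cons, List.length_cons,
        List.length_nil, cont_cons_cons, cont_sub_one_cons, cont_singleton, cont_nil]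
      ring
    | cons y A =>
      have h := ih (by simp)
      simp only [List.cons_append, List.tail_cons, List.length_cons, cont_cons_cons x y] at h ⊢
      rw [pow_succ]
      linear_combination -h
end

section
/- Let m ≥ 2 and let a₁, …, a_m be positive integers. Then the sum over l = 1, …, m − 1 of the continuants K(a_{l+1} − 1, a_{l+2},…,a_m) equals K(a₂,…,a_m) − 1. (In terms of the paper: for a Haros graph G_{p/q} with p/q = [a₁,…,a_m], the total number of nodes of degree ≥ 5 other than the boundary node equals p − 1.) -/
/-- Decrement the head of a list (used to form `K(a_{l+1} − 1, a_{l+2},…,a_m)`). -/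
def headSubOne : List ℤ → List ℤ
  | [] => []
  | a :: t => (a - 1) :: t

theorem contAux_append_singleton_sub {R : Type*} [CommRing R] (x y : R) :
    ∀ s : List R, contAux (s ++ [x - y]) = contAux (s ++ [x]) - y * contAux s
  | [] => by simp [contAux]
  | [z] => by
    simp only [List.cons_append, List.nil_append, contAux]
    ring
  | z :: w :: t => by
    have h₁ := contAux_append_singleton_sub x y (w :: t)
    have h₂ := contAux_append_singleton_sub x y t
    simp only [List.cons_append, contAux] at h₁ ⊢
    rw [h₁, h₂]
    ring

theorem cont_cons_sub_one {R : Type*} [CommRing R] (x : R) (t : List R) :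
    cont ((x - 1) :: t) = cont (x :: t) - cont t := by
  simp [cont, contAux_append_singleton_sub]

theorem sum_range_cont_headSubOne_drop (t : List ℤ) :
    ∑ l ∈ Finset.range t.length, cont (headSubOne (t.drop l)) = cont t - 1 := by
  induction t with
  | nil => simp [cont, contAux]
  | cons x t ih =>
    rw [List.length_cons, Finset.sum_range_succ']
    simp only [List.drop_succ_cons, List.drop_zero, ih]
    rw [headSubOne, cont_cons_sub_one]
    ring

/-- for `m ≥ 2` and positive integers `a₁,…,a_m` (the list `L`),
`∑_{l=1}^{m−1} K(a_{l+1} − 1, a_{l+2},…,a_m) = K(a₂,…,a_m) − 1`. -/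
theorem sum_cont_headSubOne (L : List ℤ) (hm : 2 ≤ L.length)
    (hpos : ∀ a ∈ L, 0 < a) :
    ∑ l ∈ Finset.Icc 1 (L.length - 1), cont (headSubOne (L.drop l))
      = cont L.tail - 1 := by
  rw [← sum_range_cont_headSubOne_drop, List.length_tail, Finset.range_eq_Ico,
    ← Finset.Ico_add_one_right_eq_Icc]
  simp only [List.drop_tail]
  exact (Finset.sum_Ico_add' (fun l => cont (headSubOne (L.drop l))) 0 (L.length - 1) 1).symm
end

section
/- Let r ≥ 1 and let α₁, …, α_r be positive integers with α_r ≥ 2. If a rational number x lies strictly between the two values [α₁,…,α_r] and [α₁,…,α_{r−1}, α_r − 1, 2], then x admits a continued fraction expansion of the form x = [α₁,…,α_{r−1}, α_r − 1, 1, b_{r+2},…,b_m] for some m > r + 1 and positive integers b_{r+2}, …, b_m. -/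
/-- The value of the finite continued fraction `[a₁,…,aₙ] = 1/(a₁ + 1/(a₂ + ⋯ + 1/aₙ))`
(with the empty continued fraction valued `0`). -/
def cfVal : List ℚ → ℚ
  | [] => 0
  | a :: t => 1 / (a + cfVal t)

/-- The monadic coercion of a list of integers to a list of rationals is the entrywise cast. -/
theorem map_bind_pure_cast (l : List ℤ) :
    (l >>= fun a => pure (a : ℚ)).map (fun a => a) = l.map ((↑) : ℤ → ℚ) := by
  rw [List.map_id']
  exact List.flatMap_pure_eq_map _ l

/-- The value of a continued fraction with positive partial quotients is nonnegative. -/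
theorem cfVal_map_nonneg (l : List ℤ) (hl : ∀ a ∈ l, 0 < a) :
    0 ≤ cfVal (l.map ((↑) : ℤ → ℚ)) := by
  induction l with
  | nil => simp [cfVal]
  | cons a t ih =>
    have ha : (0 : ℚ) < a := by exact_mod_cast hl a (by simp)
    have ht := ih fun c hc => hl c (by simp [hc])
    simp only [List.map_cons, cfVal]
    positivity

/-- Every rational in `(0, 1)` has a continued fraction expansion with positive partial
quotients. -/
theorem exists_eq_cfVal_map_of_lt_one (z : ℚ) (hz0 : 0 < z) (hz1 : z < 1) :
    ∃ (b : ℤ) (bs : List ℤ), 0 < b ∧ (∀ c ∈ bs, 0 < c) ∧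
      z = cfVal ((b :: bs).map ((↑) : ℤ → ℚ)) := by
  induction hn : z.num.toNat using Nat.strong_induction_on generalizing z with
  | _ n ih =>
    have hb : 0 < ⌊z⁻¹⌋ := Int.floor_pos.2 (one_le_inv₀ hz0 |>.2 hz1.le)
    have hdecomp : z = 1 / ((⌊z⁻¹⌋ : ℚ) + Int.fract z⁻¹) := by
      rw [Int.floor_add_fract, one_div, inv_inv]
    rcases (Int.fract_nonneg z⁻¹).eq_or_lt with h0 | h0
    · refine ⟨⌊z⁻¹⌋, [], hb, by simp, ?_⟩
      rw [← h0] at hdecomp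
      simpa [cfVal] using hdecomp
    · have hlt := Rat.fract_inv_num_lt_num_of_pos hz0
      have hpos := Rat.num_pos.2 hz0
      obtain ⟨c, cs, hc, hcs, he⟩ :=
        ih _ (by omega) (Int.fract z⁻¹) h0 (Int.fract_lt_one _) rfl
      refine ⟨⌊z⁻¹⌋, c :: cs, hb, by simpa using ⟨hc, hcs⟩, ?_⟩
      rw [List.map_cons, cfVal, ← he]
      exact hdecomp

/-- If `x` lies between `1 / (a + u)` and `1 / (a + v)`, then `x⁻¹ - a` lies between `v`
and `u`. -/
theorem inv_sub_mem_Ioo {a u v x : ℚ} (ha : 0 < a) (hu : 0 ≤ u) (hv : 0 ≤ v)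
    (hl : 1 / (a + u) < x) (hr : x < 1 / (a + v)) :
    0 < x ∧ v < x⁻¹ - a ∧ x⁻¹ - a < u := by
  have hx : 0 < x := lt_trans (by positivity) hl
  rw [one_div] at hl hr
  have h₁ := inv_lt_of_inv_lt₀ (by positivity) hl
  have h₂ := (lt_inv_comm₀ hx (by positivity)).1 hr
  exact ⟨hx, by linarith, by linarith⟩

/-- The two endpoints may occur in either order, depending on the parity of the length. -/
theorem exists_eq_cfVal_of_between (A : List ℤ) (ar : ℤ)
    (hA : ∀ a ∈ A, 0 < a) (har : 2 ≤ ar) (x : ℚ)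
    (h : (cfVal ((A ++ [ar]).map ((↑) : ℤ → ℚ)) < x ∧
          x < cfVal ((A ++ [ar - 1, 2]).map ((↑) : ℤ → ℚ))) ∨
        (cfVal ((A ++ [ar - 1, 2]).map ((↑) : ℤ → ℚ)) < x ∧
          x < cfVal ((A ++ [ar]).map ((↑) : ℤ → ℚ)))) :
    ∃ (b : ℤ) (bs : List ℤ), 0 < b ∧ (∀ c ∈ bs, 0 < c) ∧
      x = cfVal (((A ++ [ar - 1, 1]) ++ (b :: bs)).map ((↑) : ℤ → ℚ)) := by
  induction A generalizing x with
  | nil =>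
    have har' : (2 : ℚ) ≤ ar := by exact_mod_cast har
    have h' : 0 < x ∧ 1 / 2 < x⁻¹ - (ar - 1) ∧ x⁻¹ - (ar - 1) < 1 := by
      simp only [List.nil_append, List.map_cons, List.map_nil, cfVal, Int.cast_sub,
        Int.cast_one, Int.cast_ofNat, add_zero] at h
      have hsplit : (ar : ℚ) = (ar - 1) + 1 := by ring
      rcases h with ⟨hl, hr⟩ | ⟨hl, hr⟩
      · rw [hsplit] at hl
        exact inv_sub_mem_Ioo (by linarith) (by norm_num) (by norm_num) hl (by simpa using hr)
      · have : 1 / (ar : ℚ) < 1 / (ar - 1 + 1 / 2) :=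
          one_div_lt_one_div_of_lt (by linarith) (by linarith)
        linarith
    obtain ⟨hx, hy₁, hy₂⟩ := h'
    set y := x⁻¹ - (ar - 1) with hy
    have hy₀ : 0 < y := by linarith
    have hz₀ : 1 < y⁻¹ := (one_lt_inv₀ hy₀).2 hy₂
    have hz₁ : y⁻¹ < 2 := (inv_lt_comm₀ hy₀ two_pos).2 (by linarith)
    obtain ⟨b, bs, hb, hbs, he⟩ :=
      exists_eq_cfVal_map_of_lt_one (y⁻¹ - 1) (by linarith) (by linarith)
    refine ⟨b, bs, hb, hbs, ?_⟩
    simp only [List.nil_append, List.cons_append, List.map_cons, cfVal] at he ⊢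
    rw [← he]
    simp [hy]
  | cons a t ih =>
    have ha : (0 : ℚ) < a := by exact_mod_cast hA a (by simp)
    have ht : ∀ c ∈ t, 0 < c := fun c hc => hA c (by simp [hc])
    have hnonneg (l : List ℤ) (hl : ∀ c ∈ l, 0 < c) :
        0 ≤ cfVal ((t ++ l).map ((↑) : ℤ → ℚ)) :=
      cfVal_map_nonneg _ fun c hc => (List.mem_append.1 hc).elim (ht c) (hl c)
    have hu := hnonneg [ar] (by simp; omega)
    have hv := hnonneg [ar - 1, 2] (by simp; omega)
    simp only [List.cons_append, List.map_cons, cfVal] at h ⊢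
    obtain ⟨b, bs, hb, hbs, he⟩ := ih ht (x⁻¹ - a) <| h.symm.imp
      (fun h => (inv_sub_mem_Ioo ha hv hu h.1 h.2).2)
      (fun h => (inv_sub_mem_Ioo ha hu hv h.1 h.2).2)
    refine ⟨b, bs, hb, hbs, ?_⟩
    rw [← he]
    simp

/-- for `r ≥ 1` and positive integers `α₁,…,α_r` (here `A ++ [ar]`) with
`α_r ≥ 2`, any rational `x` lying strictly between `[α₁,…,α_r]` and
`[α₁,…,α_{r−1}, α_r − 1, 2]` has a continued fraction expansion
`x = [α₁,…,α_{r−1}, α_r − 1, 1, b_{r+2},…,b_m]` with `m > r + 1` and positive integer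
partial quotients `b_{r+2},…,b_m`. -/
theorem cf_begins_with' (A : List ℤ) (ar : ℤ)
    (hA : ∀ a ∈ A, 0 < a) (har : 2 ≤ ar) (x : ℚ)
    (hlo : min (cfVal ((A ++ [ar]).map (fun a => (a : ℚ))))
        (cfVal ((A ++ [ar - 1, 2]).map (fun a => (a : ℚ)))) < x)
    (hhi : x < max (cfVal ((A ++ [ar]).map (fun a => (a : ℚ))))
        (cfVal ((A ++ [ar - 1, 2]).map (fun a => (a : ℚ))))) :
    ∃ (b : ℤ) (bs : List ℤ), 0 < b ∧ (∀ c ∈ bs, 0 < c) ∧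
      x = cfVal (((A ++ [ar - 1, 1]) ++ (b :: bs)).map (fun a => (a : ℚ))) := by
  simp only [map_bind_pure_cast] at hlo hhi ⊢
  refine exists_eq_cfVal_of_between A ar hA har x ?_
  rcases min_lt_iff.1 hlo with h₁ | h₁ <;> rcases lt_max_iff.1 hhi with h₂ | h₂
  · exact absurd h₁ h₂.not_gt
  · exact Or.inl ⟨h₁, h₂⟩
  · exact Or.inr ⟨h₁, h₂⟩
  · exact absurd h₁ h₂.not_gt
end
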